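/- The upper bound 1 − p_{10} − p_{0(K−1)} for θ in the confounded setting is sharp: for any probability vector (p_{xy}) there exists a joint distribution of (X, Y(0), Y(1)) consistent with observed probabilities p_{xy} = P(X = x, Y(X) = y) achieving P(Y(1) > Y(0)) = 1 − p_{10} − p_{0(K−1)}. -/

import Mathlib

/-- Sharpness of the upper bound 1 − p_{10} − p_{0(K−1)} for θ in the confounded setting.
`f x y0 y1` is the joint probability that `X = x, Y(0) = y0, Y(1) = y1`. -/
theorem stmt6 {K : ℕ} (hK : 2 ≤ K) (p : Fin 2 → Fin K → ℝ)
    (hp : ∀ x y, 0 ≤ p x y) (hsum : ∑ x, ∑ y, p x y = 1) :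
    ∃ f : Fin 2 → Fin K → Fin K → ℝ,
      (∀ x y0 y1, 0 ≤ f x y0 y1) ∧
      (∑ x, ∑ y0, ∑ y1, f x y0 y1 = 1) ∧
      (∀ y : Fin K, ∑ y1, f 0 y y1 = p 0 y) ∧
      (∀ y : Fin K, ∑ y0, f 1 y0 y = p 1 y) ∧
      (∑ x, ∑ y0, ∑ y1, (if y0 < y1 then f x y0 y1 else 0))
        = 1 - p 1 ⟨0, by omega⟩ - p 0 ⟨K - 1, by omega⟩ := by
  have hKp : 0 < K := by omega
  set z : Fin K := ⟨0, by omega⟩ with hz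
  set l : Fin K := ⟨K - 1, by omega⟩ with hl
  have hlt : ∀ y : Fin K, y < l ↔ y ≠ l := by
    intro y
    rw [hl, Fin.lt_def, ne_eq, Fin.ext_iff]
    have := y.2
    simp only
    omega
  have hgt : ∀ y : Fin K, z < y ↔ y ≠ z := by
    intro y
    rw [hz, Fin.lt_def, ne_eq, Fin.ext_iff]
    simp only
    omega
  have h0 : ∀ y0 : Fin K, ∑ y1, (if y0 < y1 then (if y1 = l then p 0 y0 else 0) else 0)
      = p 0 y0 - if y0 = l then p 0 y0 else 0 := by
    intro y0
    rw [Finset.sum_eq_single l]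
    · by_cases h : y0 = l <;> simp [hlt, h]
    · intro b _ hb
      simp [hb]
    · simp
  have h1 : ∀ y1 : Fin K, ∑ y0, (if y0 < y1 then (if y0 = z then p 1 y1 else 0) else 0)
      = p 1 y1 - if y1 = z then p 1 y1 else 0 := by
    intro y1
    rw [Finset.sum_eq_single z]
    · by_cases h : y1 = z <;> simp [hgt, h]
    · intro b _ hb
      simp [hb]
    · simp
  rw [Fin.sum_univ_two] at hsum
  refine ⟨fun x y0 y1 => if x = 0 then (if y1 = l then p 0 y0 else 0)
    else (if y0 = z then p 1 y1 else 0), ?_, ?_, ?_, ?_, ?_⟩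
  · intro x y0 y1
    dsimp only
    split_ifs <;> first | exact hp _ _ | exact le_rfl
  · rw [Fin.sum_univ_two, Finset.sum_comm (s := Finset.univ) (t := Finset.univ)
      (f := fun y0 y1 => if (1 : Fin 2) = 0 then (if y1 = l then p 0 y0 else 0)
        else (if y0 = z then p 1 y1 else 0))]
    simpa using hsum
  · intro y
    simp
  · intro y
    simp
  · rw [Fin.sum_univ_two]
    simp only [if_true, one_ne_zero, if_false]
    rw [Finset.sum_comm (f := fun y0 y1 => if y0 < y1 then (if y0 = z then p 1 y1 else 0) else 0)]
    simp only [h0, h1, Finset.sum_sub_distrib, Finset.sum_ite_eq', Finset.mem_univ, if_true]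
    linarith
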